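/- Let P=(H,K) be a bialgebra R-pairing, (M,ϱ_M) a right K-comodule, and equip M with the induced left H-module structure h·m = Σ m_{<0>}⟨h,m_{<1>}⟩. If the map α_M^P: M⊗_R K → Hom_R(H,M) is injective, then the H-invariants coincide with the K-coinvariants: M^H = M^{coK}. -/

import Mathlib

open TensorProduct

universe u

/-- The canonical map `α^P_M : M ⊗ C → Hom(A, M)` associated to an `R`-pairing
`β : A → C → R`, sending `Σ mᵢ ⊗ cᵢ` to `a ↦ Σ ⟨a, cᵢ⟩ • mᵢ`. -/
noncomputable def alphaMap (R : Type u) [CommRing R]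
    {A : Type u} [AddCommGroup A] [Module R A]
    {C : Type u} [AddCommGroup C] [Module R C]
    (β : A →ₗ[R] C →ₗ[R] R)
    (M : Type u) [AddCommGroup M] [Module R M] :
    (M ⊗[R] C) →ₗ[R] (A →ₗ[R] M) :=
  (dualTensorHom R A M) ∘ₗ
    (TensorProduct.comm R M (Module.Dual R A)).toLinearMap ∘ₗ
    (TensorProduct.map LinearMap.id β.flip)

/-- `(A, C)` is a measuring pairing: `κ_P : A → C*` is multiplicative into the
convolution algebra `C*`. -/
def IsMeasuring (R : Type u) [CommRing R]
    {A : Type u} [NonUnitalRing A] [Module R A]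
    {C : Type u} [AddCommGroup C] [Module R C] [Coalgebra R C]
    (β : A →ₗ[R] C →ₗ[R] R) : Prop :=
  ∀ a b : A,
    β (a * b) =
      (LinearMap.mul' R R) ∘ₗ (TensorProduct.map (β a) (β b)) ∘ₗ
        (Coalgebra.comul (R := R) (A := C))

/-- The rational submodule `Rat^C(M)` of a module with `A`-action `σ`. -/
noncomputable def ratSubmodule (R : Type u) [CommRing R]
    {A : Type u} [AddCommGroup A] [Module R A]
    {C : Type u} [AddCommGroup C] [Module R C]
    (β : A →ₗ[R] C →ₗ[R] R)
    {M : Type u} [AddCommGroup M] [Module R M]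
    (σ : A →ₗ[R] M →ₗ[R] M) : Submodule R M :=
  (LinearMap.range (alphaMap R β M)).comap σ.flip

/-- The `A`-action induced on a right `C`-comodule: `a • m = Σ m₍₀₎⟨a, m₍₁₎⟩`. -/
noncomputable def inducedAction (R : Type u) [CommRing R]
    {A : Type u} [AddCommGroup A] [Module R A]
    {C : Type u} [AddCommGroup C] [Module R C]
    (β : A →ₗ[R] C →ₗ[R] R)
    {M : Type u} [AddCommGroup M] [Module R M]
    (ϱ : M →ₗ[R] M ⊗[R] C) : A →ₗ[R] M →ₗ[R] M :=
  ((alphaMap R β M) ∘ₗ ϱ).flip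

/-- `ϱ : M → M ⊗ C` is a (coassociative, counital) right `C`-comodule structure. -/
def IsRightComodule (R : Type u) [CommRing R]
    {C : Type u} [AddCommGroup C] [Module R C] [Coalgebra R C]
    {M : Type u} [AddCommGroup M] [Module R M]
    (ϱ : M →ₗ[R] M ⊗[R] C) : Prop :=
  ((TensorProduct.assoc R M C C).toLinearMap ∘ₗ (TensorProduct.map ϱ LinearMap.id) ∘ₗ ϱ
      = (TensorProduct.map LinearMap.id (Coalgebra.comul (R := R))) ∘ₗ ϱ)
  ∧ ∀ m : M,
      (TensorProduct.rid R M)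
        ((TensorProduct.map LinearMap.id (Coalgebra.counit (R := R))) (ϱ m)) = m

/-- `ϱ : N → C ⊗ N` is a (coassociative, counital) left `C`-comodule structure. -/
def IsLeftComodule (R : Type u) [CommRing R]
    {C : Type u} [AddCommGroup C] [Module R C] [Coalgebra R C]
    {N : Type u} [AddCommGroup N] [Module R N]
    (ϱ : N →ₗ[R] C ⊗[R] N) : Prop :=
  ((TensorProduct.assoc R C C N).symm.toLinearMap ∘ₗ (TensorProduct.map LinearMap.id ϱ) ∘ₗ ϱ
      = (TensorProduct.map (Coalgebra.comul (R := R)) LinearMap.id) ∘ₗ ϱ)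
  ∧ ∀ n : N,
      (TensorProduct.lid R N)
        ((TensorProduct.map (Coalgebra.counit (R := R)) LinearMap.id) (ϱ n)) = n

/-- The cotensor product `M □_C N` as a submodule of `M ⊗ N`. -/
noncomputable def cotensor (R : Type u) [CommRing R]
    {C : Type u} [AddCommGroup C] [Module R C]
    {M : Type u} [AddCommGroup M] [Module R M]
    {N : Type u} [AddCommGroup N] [Module R N]
    (ϱM : M →ₗ[R] M ⊗[R] C) (ϱN : N →ₗ[R] C ⊗[R] N) : Submodule R (M ⊗[R] N) :=
  LinearMap.ker
    ((TensorProduct.assoc R M C N).toLinearMap ∘ₗ (TensorProduct.map ϱM LinearMap.id)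
      - (TensorProduct.map LinearMap.id ϱN))

/-- The right `A`-action induced on a left `C`-comodule: `n • a = Σ ⟨a, n₍₋₁₎⟩ n₍₀₎`. -/
noncomputable def rAct (R : Type u) [CommRing R]
    {A : Type u} [AddCommGroup A] [Module R A]
    {C : Type u} [AddCommGroup C] [Module R C]
    {N : Type u} [AddCommGroup N] [Module R N]
    (β : A →ₗ[R] C →ₗ[R] R) (ϱ : N →ₗ[R] C ⊗[R] N) (a : A) : N →ₗ[R] N :=
  (TensorProduct.lid R N).toLinearMap ∘ₗ (TensorProduct.map (β a) LinearMap.id) ∘ₗ ϱ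

/-- `Hom_{A-}(B, N)`: the `A`-linear maps `B → N`, where `B` is an `A`-module via `ξ`. -/
noncomputable def homA (R : Type u) [CommRing R]
    {A B N : Type u} [Ring A] [Algebra R A] [Ring B] [Algebra R B]
    [AddCommGroup N] [Module R N]
    (ξ : A →ₐ[R] B) (σN : A →ₗ[R] N →ₗ[R] N) : Submodule R (B →ₗ[R] N) where
  carrier := {f | ∀ (a : A) (b : B), f (ξ a * b) = σN a (f b)}
  zero_mem' := by intro a b; simp
  add_mem' := by intro f g hf hg a b; simp [hf a b, hg a b]
  smul_mem' := by intro r f hf a b; simp [hf a b]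

/-- Evaluation at `1_B` as a linear map on a submodule of `Hom_R(B, N)`. -/
noncomputable def evalAtOne {R B N : Type u} [CommRing R] [Ring B] [Algebra R B]
    [AddCommGroup N] [Module R N] (Hsub : Submodule R (B →ₗ[R] N)) : ↥Hsub →ₗ[R] N where
  toFun f := (f : B →ₗ[R] N) 1
  map_add' f g := by simp
  map_smul' r f := by simp

/-- `(H, K)` is a bialgebra `R`-pairing: both induced maps `H → K*` and `K → H*` are
unital algebra morphisms into the respective convolution algebras. -/
def IsBialgebraPairing (R : Type u) [CommRing R]
    {H : Type u} [Ring H] [Bialgebra R H]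
    {K : Type u} [Ring K] [Bialgebra R K]
    (β : H →ₗ[R] K →ₗ[R] R) : Prop :=
  (∀ h h' : H, β (h * h') =
      (LinearMap.mul' R R) ∘ₗ (TensorProduct.map (β h) (β h')) ∘ₗ
        (Coalgebra.comul (R := R) (A := K)))
  ∧ (∀ k k' : K, β.flip (k * k') =
      (LinearMap.mul' R R) ∘ₗ (TensorProduct.map (β.flip k) (β.flip k')) ∘ₗ
        (Coalgebra.comul (R := R) (A := H)))
  ∧ β 1 = Coalgebra.counit (R := R)
  ∧ β.flip 1 = Coalgebra.counit (R := R)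

@[simp]
lemma alphaMap_tmul (R : Type u) [CommRing R]
    {A : Type u} [AddCommGroup A] [Module R A]
    {C : Type u} [AddCommGroup C] [Module R C]
    (β : A →ₗ[R] C →ₗ[R] R)
    (M : Type u) [AddCommGroup M] [Module R M] (m : M) (c : C) (a : A) :
    alphaMap R β M (m ⊗ₜ[R] c) a = β a c • m := by
  simp [alphaMap]

/-- Let `P = (H,K)` be a bialgebra `R`-pairing and `(M, ϱM)` a right
`K`-comodule with the induced left `H`-action `h · m = Σ m₍₀₎⟨h, m₍₁₎⟩`. If `α_M^P` is
injective, then the `H`-invariants coincide with the `K`-coinvariants: `M^H = M^{coK}`. -/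
theorem invariants_eq_coinvariants
    {R H K M : Type u} [CommRing R]
    [Ring H] [Bialgebra R H] [Ring K] [Bialgebra R K]
    [AddCommGroup M] [Module R M]
    (β : H →ₗ[R] K →ₗ[R] R)
    (hpair : IsBialgebraPairing R β)
    (ϱM : M →ₗ[R] M ⊗[R] K) (hM : IsRightComodule R ϱM)
    (hα : Function.Injective (alphaMap R β M)) :
    ∀ m : M,
      (∀ h : H, inducedAction R β ϱM h m = Coalgebra.counit (R := R) h • m)
      ↔ ϱM m = m ⊗ₜ[R] (1 : K) := by
  intro m
  have hone (h : H) : β h 1 = Coalgebra.counit (R := R) h :=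
    LinearMap.congr_fun hpair.2.2.2 h
  rw [← hα.eq_iff, LinearMap.ext_iff]
  refine forall_congr' fun h => ?_
  rw [alphaMap_tmul, hone]
  rfl
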